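/- Let D be an open subset of ℝ^n, F : D → ℝ^n a C¹-mapping, K̃ a compact subset of D, and K ⊆ K̃. Fix T with 0 < T < ∞ and suppose that every solution q(t) of the ODE q̇ = F(q) with q(0) ∈ K is defined on I = [0, T] and satisfies q(t) ∈ K̃ for all t ∈ I. Then for every ε > 0 there exist an integer m ≥ 1, a time constant τ > 0, an n × m matrix A, an m × n matrix B, and a vector θ ∈ ℝ^m with the following property: for every solution q(t) of q̇ = F(q) with q(0) ∈ K, the (unique) solution s : [0,T] → ℝ^{n+m} of the recurrent-network ODE ṡ = −(1/τ)s + W σ(s), with block weight matrix W = [[0, A],[0, B A]] and initial state s(0) = (q(0), B q(0) + θ), satisfies max_{t ∈ [0,T]} ‖q(t) − ω(t)‖ < ε, where ω(t) ∈ ℝ^n denotes the first n components of s(t). -/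

import Mathlib

/-- The logistic sigmoid function. -/
noncomputable def sigmoid (x : ℝ) : ℝ := 1 / (1 + Real.exp (-x))

lemma continuous_sigmoid' : Continuous sigmoid := by
  unfold sigmoid
  refine continuous_const.div (by fun_prop) (fun x => ?_)
  positivity

lemma sigmoid_exp_bound (y d : ℝ) :
    |Real.exp y - Real.exp (-d) * sigmoid (y + d)| ≤ Real.exp (2 * y + d) := by
  have h1 : Real.exp y - Real.exp (-d) * sigmoid (y + d)
      = Real.exp (2 * y + d) / (1 + Real.exp (y + d)) := by
    unfold sigmoid
    have e1 : Real.exp (-(y + d)) = (Real.exp y)⁻¹ * (Real.exp d)⁻¹ := by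
      rw [Real.exp_neg, Real.exp_add, mul_inv]
    have e2 : Real.exp (2 * y + d) = Real.exp y * Real.exp y * Real.exp d := by
      rw [← Real.exp_add, ← Real.exp_add]; ring_nf
    rw [e1, e2, Real.exp_neg, Real.exp_add]
    have := Real.exp_pos y
    have := Real.exp_pos d
    field_simp
    ring
  rw [h1, abs_of_nonneg (by positivity)]
  exact div_le_self (by positivity) (by linarith [Real.exp_pos (y + d)])

/-- The ridge functions as continuous maps on a set. -/
noncomputable def ridge {n : ℕ} (C : Set (EuclideanSpace ℝ (Fin n))) (p : (Fin n → ℝ) × ℝ) :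
    C(C, ℝ) :=
  ⟨fun x => sigmoid (∑ k, p.1 k * x.1 k + p.2), by
    refine continuous_sigmoid'.comp ?_
    fun_prop⟩

/-- Exponentials of linear functionals, as a monoid homomorphism. -/
noncomputable def expHom {n : ℕ} (C : Set (EuclideanSpace ℝ (Fin n))) :
    Multiplicative (Fin n → ℝ) →* C(C, ℝ) where
  toFun b := ⟨fun x => Real.exp (∑ k, (Multiplicative.toAdd b) k * x.1 k), by fun_prop⟩
  map_one' := by ext x; simp
  map_mul' a b := by
    ext x
    simp [add_mul, Finset.sum_add_distrib, Real.exp_add]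

lemma ridge_dense {n : ℕ} (C : Set (EuclideanSpace ℝ (Fin n))) [CompactSpace C]
    (f : C(C, ℝ)) : f ∈ (Submodule.span ℝ (Set.range (ridge C))).topologicalClosure := by
  set S := (Submodule.span ℝ (Set.range (ridge C))).topologicalClosure with hS
  have h1 : ∀ b, expHom C b ∈ S := by
    intro b
    rw [hS, ← SetLike.mem_coe, Submodule.topologicalClosure_coe, Metric.mem_closure_iff]
    intro ε hε
    have hc : Continuous (fun x : C => ∑ k, (Multiplicative.toAdd b) k * x.1 k) := by fun_prop
    obtain ⟨M, hM⟩ := (isCompact_range hc).bddAbove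
    set d := Real.log (ε / 2) - 2 * M with hd
    refine ⟨Real.exp (-d) • ridge C (Multiplicative.toAdd b, d),
      Submodule.smul_mem _ _ (Submodule.subset_span ⟨_, rfl⟩), ?_⟩
    refine lt_of_le_of_lt ((ContinuousMap.dist_le (by positivity : 0 ≤ ε / 2)).2 fun x => ?_)
      (half_lt_self hε)
    have hx := hM ⟨x, rfl⟩
    have := sigmoid_exp_bound (∑ k, (Multiplicative.toAdd b) k * x.1 k) d
    rw [Real.dist_eq]
    refine this.trans ?_
    rw [← Real.le_log_iff_exp_le (half_pos hε)]
    simp only at hx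
    linarith
  have h2 : (Algebra.adjoin ℝ (Set.range (expHom C))).topologicalClosure = ⊤ := by
    refine ContinuousMap.subalgebra_topologicalClosure_eq_top_of_separatesPoints _ ?_
    intro x y hxy
    obtain ⟨i, hi⟩ : ∃ i, x.1 i ≠ y.1 i := by
      by_contra! h
      exact hxy (Subtype.ext (PiLp.ext h))
    refine ⟨_, ⟨expHom C (Multiplicative.ofAdd (Pi.single i 1)),
      Algebra.subset_adjoin ⟨_, rfl⟩, rfl⟩, ?_⟩
    simpa [expHom, Pi.single_apply] using hi
  have h3 : ((Algebra.adjoin ℝ (Set.range (expHom C)) : Subalgebra ℝ C(C, ℝ)) : Set C(C, ℝ)) ⊆ S := by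
    have : Set.range (expHom C) = (MonoidHom.mrange (expHom C) : Set C(C, ℝ)) := by simp
    intro g hg
    rw [SetLike.mem_coe, ← Subalgebra.mem_toSubmodule, this, Algebra.adjoin_eq_span,
      Submonoid.closure_eq] at hg
    refine Submodule.span_le.2 ?_ hg
    rintro _ ⟨b, rfl⟩
    exact h1 b
  have h4 : f ∈ (Algebra.adjoin ℝ (Set.range (expHom C))).topologicalClosure := by
    rw [h2]; trivial
  exact closure_minimal h3 (Submodule.isClosed_topologicalClosure _) h4

lemma net_approx {n : ℕ} (C : Set (EuclideanSpace ℝ (Fin n))) (hC : IsCompact C)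
    (F : EuclideanSpace ℝ (Fin n) → EuclideanSpace ℝ (Fin n)) (hF : ContinuousOn F C)
    (δ : ℝ) (hδ : 0 < δ) :
    ∃ (m : ℕ) (A : Matrix (Fin n) (Fin m) ℝ) (B : Matrix (Fin m) (Fin n) ℝ)
      (θ : EuclideanSpace ℝ (Fin m)), 1 ≤ m ∧ ∀ x ∈ C,
      ‖WithLp.toLp 2 (A.mulVec fun j => sigmoid (B.mulVec x j + θ j)) - F x‖ < δ := by
  classical
  have := isCompact_iff_compactSpace.1 hC
  obtain ⟨δ', hδ', hδ''⟩ : ∃ δ' > 0, ∀ v : EuclideanSpace ℝ (Fin n), (∀ i, |v i| < δ') → ‖v‖ < δ := by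
    have hc : Filter.Tendsto (fun v : Fin n → ℝ => ‖WithLp.toLp 2 v‖) (nhds 0) (nhds 0) := by
      have : Continuous (fun v : Fin n → ℝ => ‖WithLp.toLp 2 v‖) := by fun_prop
      simpa using this.tendsto 0
    obtain ⟨r, hr, h⟩ := Metric.eventually_nhds_iff.1 (hc.eventually_lt_const hδ)
    refine ⟨r, hr, fun v hv => ?_⟩
    have := @h v.ofLp (by
      rw [dist_zero_right, pi_norm_lt_iff hr]
      exact hv)
    simpa using this
  have hi : ∀ i, ∃ c : ((Fin n → ℝ) × ℝ) →₀ ℝ, ∀ x : C,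
      |(∑ p ∈ c.support, c p * ridge C p x) - F x i| < δ' := by
    intro i
    have hcont : Continuous (fun x : C => F x i) :=
      (EuclideanSpace.proj (𝕜 := ℝ) i).continuous.comp
        (continuousOn_iff_continuous_domRestrict.1 hF)
    have := ridge_dense C ⟨fun x => F x i, hcont⟩
    rw [← SetLike.mem_coe, Submodule.topologicalClosure_coe, Metric.mem_closure_iff] at this
    obtain ⟨g, hg, hd⟩ := this δ' hδ'
    obtain ⟨c, hc⟩ := Finsupp.mem_span_range_iff_exists_finsupp.1 hg
    refine ⟨c, fun x => ?_⟩
    have h2 := lt_of_le_of_lt (ContinuousMap.dist_apply_le_dist x) hd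
    rw [dist_comm, Real.dist_eq, ← hc] at h2
    simpa [Finsupp.sum, ContinuousMap.sum_apply] using h2
  choose c hc using hi
  set S : Finset ((Fin n → ℝ) × ℝ) := insert 0 (Finset.univ.biUnion fun i => (c i).support) with hS
  let e := S.equivFin
  refine ⟨S.card, fun i j => c i (e.symm j).1, fun j k => (e.symm j).1.1 k,
    WithLp.toLp 2 fun j => (e.symm j).1.2, Finset.card_pos.2 ⟨0, by simp [hS]⟩, fun x hx => ?_⟩
  apply hδ''
  intro i
  refine lt_of_eq_of_lt (congrArg (fun z => |z - F x i|) ?_) (hc i ⟨x, hx⟩)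
  have h1 : (c i).support ⊆ S := fun p hp =>
    Finset.mem_insert_of_mem (Finset.mem_biUnion.2 ⟨i, Finset.mem_univ _, hp⟩)
  rw [Finset.sum_subset h1 (fun p _ hp => by simp [Finsupp.notMem_support_iff.1 hp]),
    ← Finset.sum_coe_sort S, ← e.symm.sum_comp]
  simp [Matrix.mulVec, dotProduct, ridge]

lemma linear_decay (z : ℝ → ℝ) (κ T : ℝ)
    (hz : ∀ t ∈ Set.Icc (0 : ℝ) T, HasDerivAt z (-κ * z t) t) :
    ∀ t ∈ Set.Icc (0 : ℝ) T, z t = Real.exp (-κ * t) * z 0 := by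
  intro t ht
  have hd : ∀ t ∈ Set.Icc (0 : ℝ) T, HasDerivAt (fun t => Real.exp (κ * t) * z t) 0 t := by
    intro t ht
    have h1 : HasDerivAt (fun t => Real.exp (κ * t)) (Real.exp (κ * t) * κ) t := by
      simpa using ((hasDerivAt_id t).const_mul κ).exp
    refine (h1.mul (hz t ht)).congr_deriv ?_
    ring
  have := constant_of_has_deriv_right_zero
    (f := fun t => Real.exp (κ * t) * z t) (a := 0) (b := T)
    (fun t ht => (hd t ht).continuousAt.continuousWithinAt)
    (fun t ht => (hd t ⟨ht.1, ht.2.le⟩).hasDerivWithinAt) t ht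
  simp only [mul_zero, Real.exp_zero, one_mul] at this
  rw [← this, ← mul_assoc, ← Real.exp_add]
  simp

lemma bootstrap {E : Type*} [NormedAddCommGroup E] [NormedSpace ℝ E] (F : E → E)
    (q w w' : ℝ → E) (L : NNReal) (r η T : ℝ) (hr : 0 < r) (hη : 0 ≤ η)
    (hL : ∀ t ∈ Set.Icc (0 : ℝ) T, LipschitzOnWith L F (Metric.closedBall (q t) r))
    (hq : ∀ t ∈ Set.Icc (0 : ℝ) T, HasDerivAt q (F (q t)) t)
    (hw : ∀ t ∈ Set.Icc (0 : ℝ) T, HasDerivAt w (w' t) t)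
    (h0 : w 0 = q 0)
    (h : ∀ t ∈ Set.Icc (0 : ℝ) T, dist (w t) (q t) ≤ r → dist (w' t) (F (w t)) ≤ η)
    (hg : gronwallBound 0 L η T < r) :
    ∀ t ∈ Set.Icc (0 : ℝ) T, dist (w t) (q t) < r := by
  by_contra! hcon
  obtain ⟨t₀, ht₀, hbad⟩ := hcon
  have cq : ContinuousOn q (Set.Icc 0 T) := fun t ht => (hq t ht).continuousAt.continuousWithinAt
  have cw : ContinuousOn w (Set.Icc 0 T) := fun t ht => (hw t ht).continuousAt.continuousWithinAt
  set S := Set.Icc (0 : ℝ) T ∩ (fun t => dist (w t) (q t)) ⁻¹' Set.Ici r with hS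
  have hSc : IsClosed S := (show ContinuousOn (fun t => dist (w t) (q t)) (Set.Icc 0 T) from fun t ht => (cw t ht).dist (cq t ht)).preimage_isClosed_of_isClosed isClosed_Icc isClosed_Ici
  have hSb : BddBelow S := ⟨0, fun t ht => ht.1.1⟩
  have hmem : sInf S ∈ S := hSc.csInf_mem ⟨t₀, ht₀, hbad⟩ hSb
  set b := sInf S with hb
  have hsub : Set.Icc 0 b ⊆ Set.Icc 0 T := Set.Icc_subset_Icc_right hmem.1.2
  have hsub' : ∀ t ∈ Set.Ico 0 b, t ∈ Set.Icc 0 T := fun t ht => hsub ⟨ht.1, ht.2.le⟩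
  have hgood : ∀ t ∈ Set.Ico 0 b, dist (w t) (q t) ≤ r := by
    intro t ht
    by_contra! hlt
    exact absurd (csInf_le hSb ⟨hsub' t ht, hlt.le⟩) (not_le.2 ht.2)
  have key := dist_le_of_approx_trajectories_ODE_of_mem (v := fun _ => F)
    (s := fun t => Metric.closedBall (q t) r) (K := L) (f := w) (g := q) (f' := w')
    (g' := fun t => F (q t)) (a := 0) (b := b) (εf := η) (εg := 0) (δ := 0)
    (fun t ht => hL t (hsub' t ht)) (cw.mono hsub)
    (fun t ht => (hw t (hsub' t ht)).hasDerivWithinAt)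
    (fun t ht => h t (hsub' t ht) (hgood t ht)) (fun t ht => hgood t ht) (cq.mono hsub)
    (fun t ht => (hq t (hsub' t ht)).hasDerivWithinAt) (fun t _ => by simp)
    (fun t _ => Metric.mem_closedBall_self hr.le) (by simp [h0]) b ⟨hmem.1.1, le_rfl⟩
  have h2 : gronwallBound 0 L (η + 0) (b - 0) ≤ gronwallBound 0 L η T := by
    rw [add_zero, sub_zero]
    exact gronwallBound_mono le_rfl hη L.2 hmem.1.2
  have h3 : r ≤ dist (w b) (q b) := hmem.2
  linarith

lemma exists_small_rate {n m : ℕ} (C : Set (EuclideanSpace ℝ (Fin n))) (hC : IsCompact C)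
    (A : Matrix (Fin n) (Fin m) ℝ) (B : Matrix (Fin m) (Fin n) ℝ)
    (θ : EuclideanSpace ℝ (Fin m)) (T δ : ℝ) (hδ : 0 < δ) :
    ∃ κ > 0, ∀ x ∈ C, ∀ t ∈ Set.Icc (0 : ℝ) T,
      ‖(-κ) • x + WithLp.toLp 2
          (A.mulVec fun j => sigmoid (B.mulVec x j + Real.exp (-κ * t) * θ j))
        - WithLp.toLp 2 (A.mulVec fun j => sigmoid (B.mulVec x j + θ j))‖ < δ := by
  have hcont : Continuous (fun z : ℝ × (EuclideanSpace ℝ (Fin n) × ℝ) =>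
      ‖(-z.1) • z.2.1 + WithLp.toLp 2
          (A.mulVec fun j => sigmoid (B.mulVec z.2.1 j + Real.exp (-z.1 * z.2.2) * θ j))
        - WithLp.toLp 2 (A.mulVec fun j => sigmoid (B.mulVec z.2.1 j + θ j))‖) := by
    have h1 : ∀ j, Continuous fun z : ℝ × (EuclideanSpace ℝ (Fin n) × ℝ) =>
        B.mulVec z.2.1 j := by
      intro j
      simp only [Matrix.mulVec, dotProduct]
      fun_prop
    have h2 : Continuous fun z : ℝ × (EuclideanSpace ℝ (Fin n) × ℝ) =>
        A.mulVec fun j => sigmoid (B.mulVec z.2.1 j + Real.exp (-z.1 * z.2.2) * θ j) := by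
      refine Continuous.matrix_mulVec continuous_const (continuous_pi fun j => ?_)
      have := h1 j
      exact continuous_sigmoid'.comp (by fun_prop)
    have h3 : Continuous fun z : ℝ × (EuclideanSpace ℝ (Fin n) × ℝ) =>
        A.mulVec fun j => sigmoid (B.mulVec z.2.1 j + θ j) := by
      refine Continuous.matrix_mulVec continuous_const (continuous_pi fun j => ?_)
      have := h1 j
      exact continuous_sigmoid'.comp (by fun_prop)
    fun_prop
  have hev := (hC.prod (isCompact_Icc (a := (0 : ℝ)) (b := T))).eventually_forall_of_forall_eventually
    (x₀ := (0 : ℝ)) (P := fun κ (p : EuclideanSpace ℝ (Fin n) × ℝ) =>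
      ‖(-κ) • p.1 + WithLp.toLp 2
          (A.mulVec fun j => sigmoid (B.mulVec p.1 j + Real.exp (-κ * p.2) * θ j))
        - WithLp.toLp 2 (A.mulVec fun j => sigmoid (B.mulVec p.1 j + θ j))‖ < δ)
    (fun p _ => by
      refine (hcont.tendsto (0, p)).eventually_lt_const ?_
      simpa using hδ)
  obtain ⟨κ, hκ, hκ0⟩ := ((hev.filter_mono nhdsWithin_le_nhds).and
    (self_mem_nhdsWithin (a := (0 : ℝ)) (s := Set.Ioi 0))).exists
  exact ⟨κ, hκ0, fun x hx t ht => hκ (x, t) ⟨hx, ht⟩⟩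

lemma hasDerivAt_coord {ι : Type*} [Fintype ι] {f : ℝ → EuclideanSpace ℝ ι}
    {f' : EuclideanSpace ℝ ι} {t : ℝ} :
    HasDerivAt f f' t ↔ ∀ i, HasDerivAt (fun t => f t i) (f' i) t := by
  constructor
  · intro h i
    exact ((EuclideanSpace.proj (𝕜 := ℝ) i).hasFDerivAt).comp_hasDerivAt t h
  · intro h
    have h1 : HasDerivAt (fun t => (f t).ofLp) f'.ofLp t := hasDerivAt_pi.2 h
    exact ((EuclideanSpace.equiv ι ℝ).symm.hasFDerivAt).comp_hasDerivAt t h1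

lemma network_output {n m : ℕ} (A : Matrix (Fin n) (Fin m) ℝ) (B : Matrix (Fin m) (Fin n) ℝ)
    (θ : EuclideanSpace ℝ (Fin m)) (T κ : ℝ) (x₀ : EuclideanSpace ℝ (Fin n))
    (s : ℝ → EuclideanSpace ℝ (Fin n ⊕ Fin m))
    (hs : ∀ t ∈ Set.Icc (0 : ℝ) T, HasDerivAt s
            ((-κ) • s t + (EuclideanSpace.equiv (Fin n ⊕ Fin m) ℝ).symm
              ((Matrix.fromBlocks 0 A 0 (B * A)).mulVec (fun j => sigmoid (s t j)))) t)
    (h0 : s 0 = (EuclideanSpace.equiv (Fin n ⊕ Fin m) ℝ).symm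
            (Sum.elim x₀ (fun i => B.mulVec x₀ i + θ i)))
    (w : ℝ → EuclideanSpace ℝ (Fin n)) (hw : ∀ t i, w t i = s t (Sum.inl i)) :
    w 0 = x₀ ∧ ∀ t ∈ Set.Icc (0 : ℝ) T, HasDerivAt w
      ((-κ) • w t + WithLp.toLp 2
          (A.mulVec fun j => sigmoid (B.mulVec (w t) j + Real.exp (-κ * t) * θ j))) t := by
  have hw0 : w 0 = x₀ := by
    ext i
    rw [hw, h0]
    simp
  refine ⟨hw0, ?_⟩
  have hcomp : ∀ t ∈ Set.Icc (0 : ℝ) T, ∀ k, HasDerivAt (fun t => s t k) (-κ * s t k +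
      ((Matrix.fromBlocks 0 A 0 (B * A)).mulVec (fun j => sigmoid (s t j))) k) t := by
    intro t ht k
    exact (hasDerivAt_coord.1 (hs t ht)) k
  have hin : ∀ t ∈ Set.Icc (0 : ℝ) T, ∀ i, HasDerivAt (fun t => w t i) (-κ * w t i +
      A.mulVec (fun j => sigmoid (s t (Sum.inr j))) i) t := by
    intro t ht i
    have := hcomp t ht (Sum.inl i)
    simp only [hw]
    convert this using 2
    simp [Matrix.mulVec, dotProduct]
  have hhid : ∀ t ∈ Set.Icc (0 : ℝ) T, ∀ k, HasDerivAt (fun t => s t (Sum.inr k))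
      (-κ * s t (Sum.inr k) +
      B.mulVec (A.mulVec (fun j => sigmoid (s t (Sum.inr j)))) k) t := by
    intro t ht k
    convert hcomp t ht (Sum.inr k) using 2
    rw [Matrix.mulVec_mulVec]
    simp [Matrix.mulVec, dotProduct]
  have hz : ∀ k, ∀ t ∈ Set.Icc (0 : ℝ) T,
      s t (Sum.inr k) = B.mulVec (w t) k + Real.exp (-κ * t) * θ k := by
    intro k t ht
    have := linear_decay (fun t => s t (Sum.inr k) - B.mulVec (w t) k) κ T (fun t ht => by
      have h1 : HasDerivAt (fun t => B.mulVec (w t) k) (∑ i, B k i * (-κ * w t i +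
          A.mulVec (fun j => sigmoid (s t (Sum.inr j))) i)) t := by
        simp only [Matrix.mulVec, dotProduct]
        exact HasDerivAt.fun_sum fun i _ => (hin t ht i).const_mul _
      refine ((hhid t ht k).sub h1).congr_deriv ?_
      simp only [mul_add, Finset.sum_add_distrib]
      have e1 : ∑ i, B k i * (-κ * w t i) = -κ * B.mulVec (w t) k := by
        simp only [Matrix.mulVec, dotProduct, Finset.mul_sum]
        exact Finset.sum_congr rfl fun i _ => by ring
      have e2 : ∑ i, B k i * A.mulVec (fun j => sigmoid (s t (Sum.inr j))) i
          = B.mulVec (A.mulVec (fun j => sigmoid (s t (Sum.inr j)))) k := rfl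
      rw [e1, e2]
      ring) t ht
    have e3 : s 0 (Sum.inr k) - B.mulVec (w 0) k = θ k := by
      rw [hw0, h0]
      simp
    simp only [e3] at this
    linarith
  intro t ht
  rw [hasDerivAt_coord]
  intro i
  convert hin t ht i using 1
  simp [hz _ t ht]

/-- **Theorem 1 of the paper** (Funahashi–Nakamura 1993): any dynamical system
`q̇ = F(q)` whose solutions starting in `K` stay in the compact set `K̃ ⊆ D` on `[0,T]`
can be approximated to arbitrary accuracy `ε` by a continuous-time recurrent neural
network `ṡ = -(1/τ)s + W σ(s)` with block weight matrix `W = [[0, A], [0, BA]]` and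
initial state `s(0) = (q(0), B q(0) + θ)`; the outputs `ω` (first `n` components of `s`)
track `q(t)` to within `ε` on `[0,T]`. -/
theorem rnn_approximates_dynamical_system
    (n : ℕ) (D : Set (EuclideanSpace ℝ (Fin n))) (hD : IsOpen D)
    (F : EuclideanSpace ℝ (Fin n) → EuclideanSpace ℝ (Fin n)) (hF : ContDiffOn ℝ 1 F D)
    (Ktilde : Set (EuclideanSpace ℝ (Fin n))) (hKt : IsCompact Ktilde) (hKtD : Ktilde ⊆ D)
    (K : Set (EuclideanSpace ℝ (Fin n))) (hK : K ⊆ Ktilde)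
    (T : ℝ) (hT : 0 < T)
    (hsol : ∀ q : ℝ → EuclideanSpace ℝ (Fin n),
      (∀ t ∈ Set.Icc (0 : ℝ) T, HasDerivAt q (F (q t)) t) → q 0 ∈ K →
      ∀ t ∈ Set.Icc (0 : ℝ) T, q t ∈ Ktilde)
    (ε : ℝ) (hε : 0 < ε) :
    ∃ (m : ℕ) (τ : ℝ) (A : Matrix (Fin n) (Fin m) ℝ) (B : Matrix (Fin m) (Fin n) ℝ)
      (θ : EuclideanSpace ℝ (Fin m)), 1 ≤ m ∧ 0 < τ ∧
      ∀ q : ℝ → EuclideanSpace ℝ (Fin n),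
        (∀ t ∈ Set.Icc (0 : ℝ) T, HasDerivAt q (F (q t)) t) → q 0 ∈ K →
        ∀ s : ℝ → EuclideanSpace ℝ (Fin n ⊕ Fin m),
          (∀ t ∈ Set.Icc (0 : ℝ) T, HasDerivAt s
            ((-(1 / τ)) • s t + (EuclideanSpace.equiv (Fin n ⊕ Fin m) ℝ).symm
              ((Matrix.fromBlocks 0 A 0 (B * A)).mulVec (fun j => sigmoid (s t j)))) t) →
          s 0 = (EuclideanSpace.equiv (Fin n ⊕ Fin m) ℝ).symm
            (Sum.elim (q 0) (fun i => B.mulVec (q 0) i + θ i)) →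
          ∀ t ∈ Set.Icc (0 : ℝ) T,
            ‖q t - (EuclideanSpace.equiv (Fin n) ℝ).symm (fun i => s t (Sum.inl i))‖ < ε := by

  obtain ⟨r₀, hr₀, hsub₀⟩ := hKt.exists_cthickening_subset_open hD hKtD
  set r := min r₀ ε with hrdef
  have hr : 0 < r := lt_min hr₀ hε
  set C := Metric.cthickening r Ktilde with hCdef
  have hCD : C ⊆ D := (Metric.cthickening_mono (min_le_left _ _) _).trans hsub₀
  have hC : IsCompact C := hKt.cthickening
  have hball : ∀ x ∈ Ktilde, Metric.closedBall x r ⊆ C := fun x hx =>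
    Metric.closedBall_subset_cthickening hx r
  have hfd : ContinuousOn (fderiv ℝ F) C :=
    (hF.continuousOn_fderiv_of_isOpen hD le_rfl).mono hCD
  obtain ⟨L₀, hL₀⟩ := hC.exists_bound_of_continuousOn hfd
  set L : NNReal := L₀.toNNReal with hLdef
  have hLip : ∀ x ∈ Ktilde, LipschitzOnWith L F (Metric.closedBall x r) := by
    intro x hx
    refine Convex.lipschitzOnWith_of_nnnorm_fderiv_le (𝕜 := ℝ) (fun y hy => ?_) (fun y hy => ?_)
      (convex_closedBall x r)
    · exact (hF.differentiableOn one_ne_zero).differentiableAt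
        (hD.mem_nhds (hCD (hball x hx hy)))
    · exact NNReal.le_toNNReal_of_coe_le (hL₀ y (hball x hx hy))
  obtain ⟨η, hη, hg⟩ : ∃ η > 0, gronwallBound 0 L η T < r := by
    have ht := (gronwallBound_continuous_ε 0 L T).tendsto 0
    rw [gronwallBound_ε0_δ0] at ht
    obtain ⟨η, h1, h2⟩ := (((ht.eventually_lt_const hr).filter_mono nhdsWithin_le_nhds).and
      (self_mem_nhdsWithin (a := (0 : ℝ)) (s := Set.Ioi 0))).exists
    exact ⟨η, h2, h1⟩
  obtain ⟨m, A, B, θ, hm, hnet⟩ := net_approx C hC F (hF.continuousOn.mono hCD) (η / 2)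
    (half_pos hη)
  obtain ⟨κ, hκ, hrate⟩ := exists_small_rate C hC A B θ T (η / 2) (half_pos hη)
  refine ⟨m, 1 / κ, A, B, θ, hm, by positivity, ?_⟩
  intro q hq hq0 s hs hs0 t ht
  rw [one_div_one_div] at hs
  have hqK := hsol q hq hq0
  obtain ⟨hw0, hw⟩ := network_output A B θ T κ (q 0) s hs hs0
    (fun t => (EuclideanSpace.equiv (Fin n) ℝ).symm (fun i => s t (Sum.inl i)))
    (fun t i => rfl)
  have := bootstrap F q _ _ L r η T hr hη.le (fun t ht => hLip _ (hqK t ht)) hq hw hw0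
    (fun t ht hd => by
      have hmem := hball _ (hqK t ht) hd
      have h1 := hrate _ hmem t ht
      have h2 := hnet _ hmem
      rw [dist_eq_norm]
      have h3 := norm_add_le_of_le h1.le h2.le
      rw [sub_add_sub_cancel, add_halves] at h3
      exact h3) hg t ht
  rw [dist_comm, dist_eq_norm] at this
  exact this.trans_le (min_le_right _ _)
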